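/- Let G be a minimal counterexample, with non-inner class-preserving Coleman automorphism φ of 2-power order. If N is a normal subgroup of G with 1 ≠ N ≠ G such that the quotient G/N is cyclic, then |G/N| = 2. -/

import Mathlib

/-- A finite 2-group of order `2^n` (`n ≥ 4`) is semidihedral if it is generated by
elements `a`, `b` with `a^(2^(n-1)) = 1`, `b^2 = 1` and `b⁻¹ * a * b = a^(2^(n-2) - 1)`. -/
def IsSemidihedral (S : Type*) [Group S] : Prop :=
  ∃ n : ℕ, 4 ≤ n ∧ Nat.card S = 2 ^ n ∧ ∃ a b : S,
    a ^ (2 ^ (n - 1)) = 1 ∧ b ^ 2 = 1 ∧ b⁻¹ * a * b = a ^ (2 ^ (n - 2) - 1) ∧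
    Subgroup.closure {a, b} = ⊤

/-- An automorphism is class-preserving if it maps every element to a conjugate of itself. -/
def IsClassPres {G : Type*} [Group G] (φ : MulAut G) : Prop :=
  ∀ g : G, IsConj g (φ g)

/-- An automorphism is Coleman if its restriction to every Sylow subgroup is given by
conjugation by some element of the group. -/
def IsColemanAut {G : Type*} [Group G] (φ : MulAut G) : Prop :=
  ∀ p : ℕ, p.Prime → ∀ P : Sylow p G, ∃ x : G, ∀ u ∈ (P : Subgroup G), φ u = x⁻¹ * u * x

/-- An automorphism is inner if it is conjugation by some group element. -/
def IsInnerAut {G : Type*} [Group G] (φ : MulAut G) : Prop :=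
  ∃ g : G, φ = MulAut.conj g

universe u

/-- `G`, with automorphism `φ`, is a minimal counterexample: `G` is a finite group with
semidihedral Sylow 2-subgroups, `φ` is a non-inner class-preserving Coleman automorphism
of `G` of 2-power order, and every finite group of smaller order with semidihedral Sylow
2-subgroups admits no non-inner class-preserving Coleman automorphism of 2-power order. -/
def IsMinimalCounterexample (G : Type u) [Group G] [Finite G] (φ : MulAut G) : Prop :=
  (∀ S : Sylow 2 G, IsSemidihedral (S : Subgroup G)) ∧
  ¬ IsInnerAut φ ∧ (∃ k : ℕ, orderOf φ = 2 ^ k) ∧ IsClassPres φ ∧ IsColemanAut φ ∧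
  ∀ (H : Type u) [Group H] [Finite H], Nat.card H < Nat.card G →
    (∀ S : Sylow 2 H, IsSemidihedral (S : Subgroup H)) →
    ∀ ψ : MulAut H, (∃ k : ℕ, orderOf ψ = 2 ^ k) → IsClassPres ψ → IsColemanAut ψ →
      IsInnerAut ψ

/-- Being semidihedral is invariant under isomorphism. -/
theorem IsSemidihedral.of_mulEquiv {S T : Type*} [Group S] [Group T] (e : S ≃* T)
    (h : IsSemidihedral S) : IsSemidihedral T := by
  obtain ⟨n, hn, hcard, a, b, ha, hb, hab, hcl⟩ := h
  refine ⟨n, hn, by rw [← hcard, Nat.card_congr e.toEquiv], e a, e b, ?_, ?_, ?_, ?_⟩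
  · rw [← map_pow, ha, map_one]
  · rw [← map_pow, hb, map_one]
  · rw [← map_pow, ← hab]
    simp
  · have h := congrArg (Subgroup.map e.toMonoidHom) hcl
    rw [MonoidHom.map_closure, Set.image_pair, ← MonoidHom.range_eq_map,
      MonoidHom.range_eq_top.mpr e.surjective] at h
    exact h

/-- Every homomorphism from a semidihedral group to a commutative group kills squares. -/
theorem IsSemidihedral.map_sq_eq_one {S A : Type*} [Group S] [CommGroup A]
    (h : IsSemidihedral S) (f : S →* A) (s : S) : f s ^ 2 = 1 := by
  obtain ⟨n, hn, -, a, b, ha, hb, hab, hcl⟩ := h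
  have hs : s ∈ Subgroup.closure {a, b} := hcl ▸ Subgroup.mem_top s
  suffices hle : Subgroup.closure {a, b} ≤ ((powMonoidHom 2).comp f).ker by
    simpa [MonoidHom.mem_ker] using hle hs
  have h1 : f a ^ (2 ^ (n - 2)) = f a ^ 2 := by
    have h2 := congrArg f hab
    simp only [map_mul, map_inv, map_pow, inv_mul_cancel_comm] at h2
    have h3 : 2 ^ (n - 2) = (2 ^ (n - 2) - 1) + 1 := by
      have := Nat.one_le_two_pow (n := n - 2)
      omega
    rw [h3, pow_succ, ← h2, sq]
  have h4 : f a ^ 2 = 1 := by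
    have h5 : f a ^ (2 ^ (n - 1)) = 1 := by rw [← map_pow, ha, map_one]
    have h6 : n - 1 = (n - 2) + 1 := by omega
    rw [h6, pow_succ, pow_mul, h1, ← pow_mul] at h5
    obtain ⟨k, hk⟩ : 2 * 2 ∣ 2 ^ (n - 2) := pow_dvd_pow 2 (show 2 ≤ n - 2 by omega)
    rw [← h1, hk, pow_mul, h5, one_pow]
  rw [Subgroup.closure_le]
  rintro x (rfl | rfl)
  · simpa [MonoidHom.mem_ker] using h4
  · simp [MonoidHom.mem_ker, ← map_pow, hb]

/-- In a finite group with semidihedral Sylow 2-subgroups, squares have odd order in every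
commutative image. -/
theorem exists_odd_pow_map_sq_eq_one {G A : Type*} [Group G] [Finite G] [CommGroup A]
    (hS : ∀ S : Sylow 2 G, IsSemidihedral (S : Subgroup G)) (f : G →* A) (g : G) :
    ∃ n, Odd n ∧ f (g ^ n) ^ 2 = 1 := by
  obtain ⟨k, n, hn, hk⟩ := Nat.exists_eq_two_pow_mul_odd (orderOf_pos g).ne'
  refine ⟨n, hn, ?_⟩
  have hp : IsPGroup 2 (Subgroup.zpowers (g ^ n)) := by
    refine IsPGroup.of_card (n := k) ?_
    rw [Nat.card_zpowers, orderOf_pow_of_dvd hn.pos.ne' ⟨2 ^ k, by rw [hk, mul_comm]⟩, hk,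
      Nat.mul_div_cancel _ hn.pos]
  obtain ⟨S, hle⟩ := hp.exists_le_sylow
  exact (hS S).map_sq_eq_one (f.comp (S : Subgroup G).subtype)
    ⟨g ^ n, hle (Subgroup.mem_zpowers _)⟩

/-- If an automorphism of 2-power order acts trivially modulo `M` and agrees on a set with
conjugation by an element of odd order modulo `M`, then it agrees on that set with conjugation
by an element of `M`. -/
theorem exists_mem_conj_of_odd_pow_mem {G : Type*} [Group G] {φ : MulAut G} {k n : ℕ}
    (hk : φ ^ 2 ^ k = 1) {M : Subgroup G} [M.Normal] (hM : ∀ g, (φ g : G ⧸ M) = g) {T : Set G}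
    {x : G} (hx : ∀ u ∈ T, φ u = x⁻¹ * u * x) (hn : Odd n) (hxn : x ^ n ∈ M) :
    ∃ y ∈ M, ∀ u ∈ T, φ u = y⁻¹ * u * y := by
  have hiter : ∀ j : ℕ, ∃ c : G, (c : G ⧸ M) = (x : G ⧸ M) ^ j ∧
      ∀ u ∈ T, (φ ^ j) u = c⁻¹ * u * c := by
    intro j
    induction j with
    | zero => exact ⟨1, by simp, by simp⟩
    | succ j ih =>
      obtain ⟨c, hc, hcT⟩ := ih
      refine ⟨x * φ c, ?_, fun u hu => ?_⟩
      · rw [QuotientGroup.mk_mul, hM, hc, pow_succ']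
      · rw [pow_succ', MulAut.mul_apply, hcT u hu]
        simp only [map_mul, map_inv, hx u hu]
        group
  obtain ⟨c, hc, hcT⟩ := hiter (2 ^ k)
  have hcomm : ∀ u ∈ T, Commute c u := fun u hu => by
    have h := hcT u hu
    rw [hk, MulAut.one_apply, mul_assoc, eq_inv_mul_iff_mul_eq] at h
    exact h
  have hcop : Nat.gcd n (2 ^ k) = 1 := (Nat.Coprime.pow_right k hn.coprime_two_right)
  have hbez := Nat.gcd_eq_gcd_ab n (2 ^ k)
  set r := Nat.gcdA n (2 ^ k)
  set s := Nat.gcdB n (2 ^ k)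
  have hxn' : (x : G ⧸ M) ^ n = 1 := by
    rw [← QuotientGroup.mk_pow]
    exact (QuotientGroup.eq_one_iff _).mpr hxn
  refine ⟨(c ^ s)⁻¹ * x, ?_, fun u hu => ?_⟩
  · rw [← QuotientGroup.eq_one_iff, QuotientGroup.mk_mul, QuotientGroup.mk_inv,
      QuotientGroup.mk_zpow, hc, inv_mul_eq_one]
    rw [hcop] at hbez
    calc ((x : G ⧸ M) ^ 2 ^ k) ^ s = ((x : G ⧸ M) ^ n) ^ r * ((x : G ⧸ M) ^ 2 ^ k) ^ s := by
          rw [hxn', one_zpow, one_mul]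
      _ = (x : G ⧸ M) ^ ((n : ℤ) * r + ((2 ^ k : ℕ) : ℤ) * s) := by
          rw [zpow_add, zpow_mul, zpow_mul, zpow_natCast, zpow_natCast]
      _ = x := by rw [← hbez, Nat.cast_one, zpow_one]
  · rw [hx u hu]
    have h := ((hcomm u hu).zpow_left s).eq
    simp only [mul_inv_rev, inv_inv, mul_assoc]
    rw [← mul_assoc u, ← mul_assoc (c ^ s), ← mul_assoc (c ^ s), h]
    simp [mul_assoc]

/-- Restriction of an automorphism to a subgroup modulo which it acts trivially. -/
def MulAut.restrictOfQuotient {G : Type*} [Group G] (φ : MulAut G) (M : Subgroup G) [M.Normal]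
    (hM : ∀ g, (φ g : G ⧸ M) = g) : MulAut M where
  toFun m := ⟨φ m, by
    rw [← QuotientGroup.eq_one_iff, hM]; exact (QuotientGroup.eq_one_iff _).mpr m.2⟩
  invFun m := ⟨φ.symm m, by
    rw [← QuotientGroup.eq_one_iff, ← hM, φ.apply_symm_apply]
    exact (QuotientGroup.eq_one_iff _).mpr m.2⟩
  left_inv m := by simp
  right_inv m := by simp
  map_mul' a b := by simp

theorem MulAut.coe_restrictOfQuotient {G : Type*} [Group G] (φ : MulAut G) (M : Subgroup G)
    [M.Normal] (hM : ∀ g, (φ g : G ⧸ M) = g) (m : M) :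
    (φ.restrictOfQuotient M hM m : G) = φ m := rfl

/-- An automorphism fixing `M` pointwise and acting trivially on the cyclic quotient `G ⧸ M`
has an inner `n`-th power whenever a generator of `G` modulo `M` has its `n`-th power in `M`. -/
theorem isInnerAut_pow_of_fixes {G : Type*} [Group G] {α : MulAut G} {M : Subgroup G} [M.Normal]
    (hM : ∀ g, (α g : G ⧸ M) = g) (hfix : ∀ m ∈ M, α m = m) {g : G}
    (hg : ∀ x, ∃ i : ℤ, ∃ m ∈ M, x = g ^ i * m) {n : ℕ} (hn : g ^ n ∈ M) :
    IsInnerAut (α ^ n) := by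
  have hcM : ∀ x : G, x⁻¹ * α x ∈ M := fun x => QuotientGroup.eq.mp (hM x).symm
  have hcC : ∀ x : G, ∀ m ∈ M, Commute (x⁻¹ * α x) m := fun x m hm => by
    have h := hfix (x * m * x⁻¹) (Subgroup.Normal.conj_mem ‹_› m hm x)
    simp only [map_mul, map_inv, hfix m hm] at h
    have h' : x⁻¹ * α x * m = m * (x⁻¹ * α x) := by
      rw [mul_inv_eq_iff_eq_mul] at h
      rw [mul_assoc, h]
      group
    exact h'
  set z := g⁻¹ * α g with hz
  have hαg : α g = g * z := by rw [hz]; group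
  have hkey : ∀ j : ℕ, ∃ a : G, (∀ m ∈ M, Commute a m) ∧
      a * ((g ^ j)⁻¹ * α (g ^ j)) = g⁻¹ * a * g * z ^ j := by
    intro j
    induction j with
    | zero => exact ⟨1, fun m _ => Commute.one_left m, by simp⟩
    | succ j ih =>
      obtain ⟨a, haC, ha⟩ := ih
      set c := (g ^ j)⁻¹ * α (g ^ j) with hc
      refine ⟨a * c, fun m hm => (haC m hm).mul_left (hcC _ m hm), ?_⟩
      have hsucc : (g ^ (j + 1))⁻¹ * α (g ^ (j + 1)) = g⁻¹ * c * g * z := by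
        rw [pow_succ, map_mul, hαg, hc]
        group
      have hconj : g⁻¹ * c * g ∈ M := by
        simpa using Subgroup.Normal.conj_mem ‹_› c (hcM _) g⁻¹
      have hzc : z ^ j * (g⁻¹ * c * g) = g⁻¹ * c * g * z ^ j :=
        ((hcC g _ hconj).pow_left j).eq
      calc a * c * ((g ^ (j + 1))⁻¹ * α (g ^ (j + 1)))
          = g⁻¹ * a * g * z ^ j * (g⁻¹ * c * g * z) := by rw [hsucc, ha]
        _ = g⁻¹ * a * g * (z ^ j * (g⁻¹ * c * g)) * z := by simp only [mul_assoc]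
        _ = g⁻¹ * (a * c) * g * z ^ (j + 1) := by rw [hzc, pow_succ]; group
  obtain ⟨a, haC, ha⟩ := hkey n
  rw [hfix _ hn, inv_mul_cancel, mul_one] at ha
  have hpow : ∀ j : ℕ, (α ^ j) g = g * z ^ j ∧ ∀ m ∈ M, (α ^ j) m = m := by
    intro j
    induction j with
    | zero => simp
    | succ j ih =>
      refine ⟨?_, fun m hm => ?_⟩
      · rw [pow_succ', MulAut.mul_apply, ih.1, map_mul, map_pow, hfix z (hcM g), hαg, pow_succ',
          mul_assoc]
      · rw [pow_succ', MulAut.mul_apply, ih.2 m hm, hfix m hm]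
  have hgn : (α ^ n) g = MulAut.conj a⁻¹ g := by
    rw [(hpow n).1, MulAut.conj_apply, inv_inv]
    have h : g * a = a * (g * z ^ n) := by
      simpa only [mul_assoc, mul_inv_cancel_left] using congrArg (g * ·) ha
    rw [mul_assoc, h]
    group
  refine ⟨a⁻¹, MulEquiv.ext fun x => ?_⟩
  obtain ⟨i, m, hm, rfl⟩ := hg x
  rw [map_mul, map_mul, map_zpow, map_zpow, hgn, (hpow n).2 m hm]
  congr 1
  rw [MulAut.conj_apply, inv_inv, mul_assoc, ← (haC m hm).eq]
  group

/-- If a product of an inner automorphism with `φ` has an inner power of odd exponent and `φ` has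
2-power order, then `φ` is inner. -/
theorem isInnerAut_of_odd_pow {G : Type*} [Group G] {φ : MulAut G} {k n : ℕ}
    (hk : φ ^ 2 ^ k = 1) (g : G) (hn : Odd n) (h : IsInnerAut ((MulAut.conj g * φ) ^ n)) :
    IsInnerAut φ := by
  have hnormal : (MulAut.conj : G →* MulAut G).range.Normal := by
    refine ⟨?_⟩
    rintro _ ⟨x, rfl⟩ ψ
    exact ⟨ψ x, by ext y; simp⟩
  let q := QuotientGroup.mk' (MulAut.conj : G →* MulAut G).range
  have hq : ∀ ψ : MulAut G, q ψ = 1 ↔ IsInnerAut ψ := fun ψ => by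
    rw [← MonoidHom.mem_ker, QuotientGroup.ker_mk']
    exact exists_congr fun _ => eq_comm
  rw [← hq] at h ⊢
  rw [map_pow, map_mul, (hq _).mpr ⟨g, rfl⟩, one_mul] at h
  have h2 : q φ ^ 2 ^ k = 1 := by rw [← map_pow, hk, map_one]
  have hcop : Nat.Coprime n (2 ^ k) := Nat.Coprime.pow_right k hn.coprime_two_right
  exact orderOf_eq_one_iff.mp
    (Nat.eq_one_of_dvd_coprimes hcop (orderOf_dvd_of_pow_eq_one h) (orderOf_dvd_of_pow_eq_one h2))

/-- If every element of `G` has an odd power in `M`, then the Sylow 2-subgroups of `M` are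
semidihedral as soon as those of `G` are. -/
theorem isSemidihedral_sylow_of_odd_pow_mem {G : Type*} [Group G] [Finite G]
    (hS : ∀ S : Sylow 2 G, IsSemidihedral (S : Subgroup G)) {M : Subgroup G}
    (hM : ∀ g : G, ∃ n, Odd n ∧ g ^ n ∈ M) (S : Sylow 2 M) :
    IsSemidihedral (S : Subgroup M) := by
  obtain ⟨P⟩ : Nonempty (Sylow 2 G) := inferInstance
  have hle : (P : Subgroup G) ≤ M := fun g hg => by
    obtain ⟨k, hk⟩ := P.isPGroup' ⟨g, hg⟩
    obtain ⟨n, hn, hgn⟩ := hM g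
    have hk' : g ^ 2 ^ k ∈ M := by
      have : g ^ 2 ^ k = 1 := congrArg Subtype.val hk
      rw [this]; exact M.one_mem
    have hcop : Nat.gcd n (2 ^ k) = 1 := Nat.Coprime.pow_right k hn.coprime_two_right
    have hbez := Nat.gcd_eq_gcd_ab n (2 ^ k)
    rw [hcop, Nat.cast_one] at hbez
    rw [← zpow_one g, hbez, zpow_add, zpow_mul, zpow_mul, zpow_natCast, zpow_natCast]
    exact M.mul_mem (M.zpow_mem hgn _) (M.zpow_mem hk' _)
  have e : (P : Subgroup G) ≃* (S : Subgroup M) :=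
    (Subgroup.subgroupOfEquivOfLe hle).symm.trans ((P.subtype hle).equiv S)
  exact (hS P).of_mulEquiv e

/-- In a minimal counterexample, a normal subgroup with cyclic quotient of odd order is the
whole group. -/
theorem IsMinimalCounterexample.eq_top_of_odd {G : Type u} [Group G] [Finite G] {φ : MulAut G}
    (hmin : IsMinimalCounterexample G φ) {M : Subgroup G} [M.Normal]
    (hodd : ∀ g : G, ∃ n, Odd n ∧ g ^ n ∈ M) {g : G}
    (hg : ∀ x, ∃ i : ℤ, ∃ m ∈ M, x = g ^ i * m)
    (hM : ∀ x : G, (φ x : G ⧸ M) = x) : M = ⊤ := by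
  obtain ⟨hS, hinn, ⟨k, hk⟩, hcp, hcol, hsmall⟩ := hmin
  have hφ : φ ^ 2 ^ k = 1 := hk ▸ pow_orderOf_eq_one φ
  by_contra hne
  have hcard : Nat.card M < Nat.card G :=
    lt_of_le_of_ne (Subgroup.card_le_card_group M) fun h => hne (Subgroup.eq_top_of_card_eq M h)
  set ψ := φ.restrictOfQuotient M hM
  have hψpow : ∀ (j : ℕ) (m : M), ((ψ ^ j) m : G) = (φ ^ j) m := by
    intro j
    induction j with
    | zero => simp
    | succ j ih =>
      intro m
      rw [pow_succ', pow_succ', MulAut.mul_apply, MulAut.mul_apply,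
        MulAut.coe_restrictOfQuotient, ih]
  have hψ : ψ ^ 2 ^ k = 1 := MulEquiv.ext fun m => Subtype.ext (by rw [hψpow, hφ]; rfl)
  obtain ⟨s, -, hs⟩ := (Nat.dvd_prime_pow Nat.prime_two).mp (orderOf_dvd_of_pow_eq_one hψ)
  have hψcp : IsClassPres ψ := by
    intro m
    obtain ⟨c, hc⟩ := isConj_iff.mp (hcp m)
    obtain ⟨n, hn, hcn⟩ := hodd c⁻¹
    obtain ⟨y, hy, hyT⟩ := exists_mem_conj_of_odd_pow_mem hφ hM (T := {(m : G)}) (x := c⁻¹)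
      (by rintro u rfl; rw [inv_inv, hc]) hn hcn
    refine isConj_iff.mpr ⟨⟨y, hy⟩⁻¹, Subtype.ext ?_⟩
    rw [MulAut.coe_restrictOfQuotient, hyT m rfl]
    simp
  have hψcol : IsColemanAut ψ := by
    intro p hp Q
    obtain ⟨P, hP⟩ := (Q.isPGroup'.map M.subtype).exists_le_sylow
    obtain ⟨x, hx⟩ := hcol p hp P
    obtain ⟨n, hn, hxn⟩ := hodd x
    obtain ⟨y, hy, hyT⟩ := exists_mem_conj_of_odd_pow_mem hφ hM hx hn hxn
    refine ⟨⟨y, hy⟩, fun u hu => Subtype.ext ?_⟩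
    rw [MulAut.coe_restrictOfQuotient, hyT u (hP ⟨u, hu, rfl⟩)]
    rfl
  obtain ⟨m, hm⟩ := hsmall M hcard (isSemidihedral_sylow_of_odd_pow_mem hS hodd) ψ ⟨s, hs⟩
    hψcp hψcol
  obtain ⟨n, hn, hgn⟩ := hodd g
  have hm1 : ((m : G) : G ⧸ M) = 1 := (QuotientGroup.eq_one_iff _).mpr m.2
  refine hinn (isInnerAut_of_odd_pow hφ (m : G)⁻¹ hn
    (isInnerAut_pow_of_fixes (M := M) (fun x => ?_) (fun u hu => ?_) hg hgn))
  · simp [hM, hm1]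
  · have h : φ u = m * u * (m : G)⁻¹ :=
      congrArg Subtype.val (DFunLike.congr_fun hm (⟨u, hu⟩ : M))
    rw [MulAut.mul_apply, h, MulAut.conj_apply]
    group

/-- In a minimal counterexample, every proper nontrivial cyclic quotient has order 2. -/
theorem stmt_16 (G : Type u) [Group G] [Finite G] (φ : MulAut G)
    (hmin : IsMinimalCounterexample G φ)
    (N : Subgroup G) [N.Normal] (hNbot : N ≠ ⊥) (hNtop : N ≠ ⊤)
    (hcyc : IsCyclic (G ⧸ N)) :
    Nat.card (G ⧸ N) = 2 := by
  let _ : CommGroup (G ⧸ N) := IsCyclic.commGroup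
  let f : G →* G ⧸ N := (powMonoidHom 2).comp (QuotientGroup.mk' N)
  have hf : ∀ x, f x = (x : G ⧸ N) ^ 2 := fun x => rfl
  have hle : N ≤ f.ker := fun x hx => by
    rw [MonoidHom.mem_ker, hf, (QuotientGroup.eq_one_iff x).mpr hx, one_pow]
  have hodd : ∀ g : G, ∃ n, Odd n ∧ g ^ n ∈ f.ker := fun g =>
    exists_odd_pow_map_sq_eq_one hmin.1 (QuotientGroup.mk' N) g
  obtain ⟨q, hq⟩ := hcyc.exists_generator
  obtain ⟨g, rfl⟩ := QuotientGroup.mk_surjective q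
  have hg : ∀ x, ∃ i : ℤ, ∃ m ∈ f.ker, x = g ^ i * m := fun x => by
    obtain ⟨i, hi⟩ := hq x
    refine ⟨i, (g ^ i)⁻¹ * x, hle (QuotientGroup.eq.mp ?_), by group⟩
    simpa using hi
  have hφ : ∀ x : G, (φ x : G ⧸ f.ker) = x := fun x => by
    refine (QuotientGroup.eq.mpr ?_).symm
    obtain ⟨c, hc⟩ := isConj_iff.mp (hmin.2.2.2.1 x)
    rw [← hc, MonoidHom.mem_ker]
    simp only [map_mul, map_inv, mul_inv_cancel_comm, inv_mul_cancel]
  have htop := hmin.eq_top_of_odd hodd hg hφ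
  have hdvd : Nat.card (G ⧸ N) ∣ 2 := by
    rw [← IsCyclic.exponent_eq_card]
    refine Monoid.exponent_dvd_of_forall_pow_eq_one fun c => ?_
    obtain ⟨x, rfl⟩ := QuotientGroup.mk_surjective c
    exact MonoidHom.mem_ker.mp (htop ▸ Subgroup.mem_top x : x ∈ f.ker)
  refine ((Nat.dvd_prime Nat.prime_two).mp hdvd).resolve_left fun h1 => hNtop ?_
  exact Subgroup.index_eq_one.mp h1
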